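/- Let λ ∈ ℂ. Define the change of variables x(ρ) = 8ρ²/(5+3ρ²) (a strictly increasing bijection from [0,1] to [0,1]), and for a function y on (0,1) define f(ρ) := (8 − 3x(ρ))^{(λ+3)/2}·y(x(ρ)), where the complex power is exp(((λ+3)/2)·log(8−3x)) with the real logarithm (note 8 − 3x(ρ) = 40/(5+3ρ²) > 0). Then a twice continuously differentiable function y : (0,1) → ℂ solves the Heun-type equation y″(x) + [(3(λ+5)x² − (8λ+43)x + 28)/(x(1−x)(8−3x))]·y′(x) + [((λ−1)(3(λ+9)x − 5λ − 51))/(4x(1−x)(8−3x))]·y(x) = 0 on (0,1) if and only if the corresponding f solves the spectral ODE −(1−ρ²)f″(ρ) − (6/ρ − 2(λ+3)ρ)f′(ρ) + ((λ+1)(λ+4) − Ṽ(ρ))f(ρ) = 0 on (0,1), where Ṽ(ρ) = −2(9ρ⁴ + 102ρ² − 335)/(5+3ρ²)². -/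

import Mathlib

/-- The potential `Ṽ`. -/
noncomputable def Vt (ρ : ℝ) : ℝ :=
  -2 * (9 * ρ ^ 4 + 102 * ρ ^ 2 - 335) / (5 + 3 * ρ ^ 2) ^ 2

/-- The change of variables `x(ρ) = 8ρ²/(5+3ρ²)`. -/
noncomputable def xmap (ρ : ℝ) : ℝ := 8 * ρ ^ 2 / (5 + 3 * ρ ^ 2)

/-- The transformed dependent variable
`f(ρ) = (8-3x(ρ))^((λ+3)/2)·y(x(ρ))`, with the complex power taken as
`exp(((λ+3)/2)·log(8-3x))` using the real logarithm. -/
noncomputable def fTrans (lam : ℂ) (y : ℝ → ℂ) (ρ : ℝ) : ℂ :=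
  Complex.exp ((lam + 3) / 2 * (Real.log (8 - 3 * xmap ρ) : ℂ)) * y (xmap ρ)

/-- The Heun-type equation for `y` at the point `x`. -/
noncomputable def HeunEq (lam : ℂ) (y : ℝ → ℂ) (x : ℝ) : Prop :=
  deriv (deriv y) x
    + (3 * (lam + 5) * (x : ℂ) ^ 2 - (8 * lam + 43) * (x : ℂ) + 28)
        / ((x : ℂ) * (1 - (x : ℂ)) * (8 - 3 * (x : ℂ))) * deriv y x
    + (lam - 1) * (3 * (lam + 9) * (x : ℂ) - 5 * lam - 51)
        / (4 * (x : ℂ) * (1 - (x : ℂ)) * (8 - 3 * (x : ℂ))) * y x = 0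

/-- The spectral ODE for `f` at the point `ρ`. -/
noncomputable def SpectralEq (lam : ℂ) (f : ℝ → ℂ) (ρ : ℝ) : Prop :=
  -((1 - ρ ^ 2 : ℝ) : ℂ) * deriv (deriv f) ρ
    - (((6 / ρ : ℝ) : ℂ) - 2 * (lam + 3) * (ρ : ℂ)) * deriv f ρ
    + ((lam + 1) * (lam + 4) - (Vt ρ : ℂ)) * f ρ = 0

open Set

theorem five_add_three_mul_sq_pos (ρ : ℝ) : 0 < 5 + 3 * ρ ^ 2 := by positivity

theorem hasDerivAt_xmap (ρ : ℝ) :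
    HasDerivAt xmap (80 * ρ / (5 + 3 * ρ ^ 2) ^ 2) ρ := by
  have hq := (five_add_three_mul_sq_pos ρ).ne'
  have h := (((hasDerivAt_id ρ).pow 2).const_mul 8).div
    ((((hasDerivAt_id ρ).pow 2).const_mul 3).const_add 5) hq
  refine h.congr_deriv ?_
  simp only [Pi.pow_apply, id_eq]
  field_simp
  ring

theorem strictMonoOn_xmap : StrictMonoOn xmap (Icc 0 1) := by
  intro a ha b _ hab
  unfold xmap
  rw [div_lt_div_iff₀ (five_add_three_mul_sq_pos a) (five_add_three_mul_sq_pos b)]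
  nlinarith [ha.1]

theorem xmap_zero : xmap 0 = 0 := by simp [xmap]

theorem xmap_one : xmap 1 = 1 := by norm_num [xmap]

theorem bijOn_xmap : BijOn xmap (Icc 0 1) (Icc 0 1) := by
  refine ⟨fun ρ hρ => ?_, strictMonoOn_xmap.injOn, ?_⟩
  · simpa only [xmap_zero, xmap_one] using strictMonoOn_xmap.monotoneOn.mapsTo_Icc hρ
  · have h := intermediate_value_Icc (zero_le_one (α := ℝ))
      (fun ρ _ => (hasDerivAt_xmap ρ).continuousAt.continuousWithinAt)
    rwa [xmap_zero, xmap_one] at h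

theorem xmap_mem_Ioo {ρ : ℝ} (hρ : ρ ∈ Ioo (0 : ℝ) 1) : xmap ρ ∈ Ioo (0 : ℝ) 1 := by
  have h := Ioo_subset_Icc_self hρ
  constructor
  · simpa only [xmap_zero] using strictMonoOn_xmap (left_mem_Icc.2 zero_le_one) h hρ.1
  · simpa only [xmap_one] using strictMonoOn_xmap h (right_mem_Icc.2 zero_le_one) hρ.2

theorem exists_xmap_eq {x : ℝ} (hx : x ∈ Ioo (0 : ℝ) 1) : ∃ ρ ∈ Ioo (0 : ℝ) 1, xmap ρ = x := by
  obtain ⟨ρ, hρ, rfl⟩ := bijOn_xmap.surjOn (Ioo_subset_Icc_self hx)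
  refine ⟨ρ, ⟨lt_of_le_of_ne hρ.1 ?_, lt_of_le_of_ne hρ.2 ?_⟩, rfl⟩
  · rintro rfl
    exact hx.1.ne' xmap_zero
  · rintro rfl
    exact hx.2.ne xmap_one

/-- The weight `(8 - 3x(ρ))^((λ+3)/2)`. -/
noncomputable def weight (lam : ℂ) (ρ : ℝ) : ℂ :=
  Complex.exp ((lam + 3) / 2 * (Real.log (8 - 3 * xmap ρ) : ℂ))

theorem eight_sub_three_mul_xmap (ρ : ℝ) : 8 - 3 * xmap ρ = 40 / (5 + 3 * ρ ^ 2) := by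
  have hq := (five_add_three_mul_sq_pos ρ).ne'
  unfold xmap
  field_simp
  ring

theorem ofReal_five_add_ne_zero (ρ : ℝ) : (5 + 3 * (ρ : ℂ) ^ 2) ≠ 0 := by
  exact_mod_cast (five_add_three_mul_sq_pos ρ).ne'

theorem hasDerivAt_weight (lam : ℂ) (ρ : ℝ) :
    HasDerivAt (weight lam) (weight lam ρ * (-3 * (lam + 3) * ρ / (5 + 3 * (ρ : ℂ) ^ 2))) ρ := by
  have hq := (five_add_three_mul_sq_pos ρ).ne'
  have hqc := ofReal_five_add_ne_zero ρ
  have hne : 8 - 3 * xmap ρ ≠ 0 := by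
    rw [eight_sub_three_mul_xmap]
    positivity
  have h := ((((hasDerivAt_xmap ρ).const_mul 3).const_sub 8).log hne).ofReal_comp.const_mul
    ((lam + 3) / 2) |>.cexp
  refine h.congr_deriv ?_
  rw [weight, eight_sub_three_mul_xmap]
  push_cast
  field_simp
  ring

theorem hasDerivAt_ofReal_div (ρ : ℝ) (c : ℂ) :
    HasDerivAt (fun r : ℝ => c * r / (5 + 3 * (r : ℂ) ^ 2))
      (c * (5 - 3 * (ρ : ℂ) ^ 2) / (5 + 3 * (ρ : ℂ) ^ 2) ^ 2) ρ := by
  have hqc := ofReal_five_add_ne_zero ρ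
  have hid : HasDerivAt (fun r : ℝ => (r : ℂ)) 1 ρ := (hasDerivAt_id ρ).ofReal_comp
  have h := (hid.const_mul c).div (((hid.pow 2).const_mul 3).const_add 5) hqc
  refine h.congr_deriv ?_
  simp only [Pi.pow_apply]
  field_simp
  ring

theorem hasDerivAt_ofReal_div_sq (ρ : ℝ) :
    HasDerivAt (fun r : ℝ => 80 * (r : ℂ) / (5 + 3 * (r : ℂ) ^ 2) ^ 2)
      (80 * (5 - 9 * (ρ : ℂ) ^ 2) / (5 + 3 * (ρ : ℂ) ^ 2) ^ 3) ρ := by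
  have hqc := ofReal_five_add_ne_zero ρ
  have hid : HasDerivAt (fun r : ℝ => (r : ℂ)) 1 ρ := (hasDerivAt_id ρ).ofReal_comp
  have h := (hid.const_mul 80).div ((((hid.pow 2).const_mul 3).const_add 5).pow 2)
    (pow_ne_zero 2 hqc)
  refine h.congr_deriv ?_
  simp only [Pi.pow_apply]
  field_simp
  ring

theorem HasDerivAt.comp_xmap {u : ℝ → ℂ} {u' : ℂ} {ρ : ℝ} (h : HasDerivAt u u' (xmap ρ)) :
    HasDerivAt (fun r => u (xmap r)) (80 * (ρ : ℂ) / (5 + 3 * (ρ : ℂ) ^ 2) ^ 2 * u') ρ := by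
  have h' := HasDerivAt.scomp ρ h (hasDerivAt_xmap ρ)
  refine h'.congr_deriv ?_
  rw [Complex.real_smul]
  push_cast
  rfl

theorem hasDerivAt_of_contDiffOn {y : ℝ → ℂ} (hy : ContDiffOn ℝ 2 y (Ioo 0 1)) {x : ℝ}
    (hx : x ∈ Ioo (0 : ℝ) 1) :
    HasDerivAt y (deriv y x) x ∧ HasDerivAt (deriv y) (deriv (deriv y) x) x := by
  have hn := isOpen_Ioo.mem_nhds hx
  have h1 : ContDiffOn ℝ 1 (deriv y) (Ioo 0 1) :=
    hy.deriv_of_isOpen isOpen_Ioo (by norm_num)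
  exact ⟨((hy.differentiableOn (by norm_num)).differentiableAt hn).hasDerivAt,
    ((h1.differentiableOn (by norm_num)).differentiableAt hn).hasDerivAt⟩

theorem deriv_fTrans {lam : ℂ} {y : ℝ → ℂ} (hy : ContDiffOn ℝ 2 y (Ioo 0 1)) {ρ : ℝ}
    (hρ : ρ ∈ Ioo (0 : ℝ) 1) :
    deriv (fTrans lam y) ρ = weight lam ρ *
      (-3 * (lam + 3) * ρ / (5 + 3 * (ρ : ℂ) ^ 2) * y (xmap ρ)
        + 80 * (ρ : ℂ) / (5 + 3 * (ρ : ℂ) ^ 2) ^ 2 * deriv y (xmap ρ)) := by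
  have h := (hasDerivAt_weight lam ρ).mul
    (hasDerivAt_of_contDiffOn hy (xmap_mem_Ioo hρ)).1.comp_xmap
  refine (h.congr_deriv ?_).deriv
  ring

theorem deriv_deriv_fTrans {lam : ℂ} {y : ℝ → ℂ} (hy : ContDiffOn ℝ 2 y (Ioo 0 1)) {ρ : ℝ}
    (hρ : ρ ∈ Ioo (0 : ℝ) 1) :
    deriv (deriv (fTrans lam y)) ρ = weight lam ρ *
      ((-3 * (lam + 3) * (5 - 3 * (ρ : ℂ) ^ 2) / (5 + 3 * (ρ : ℂ) ^ 2) ^ 2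
          + (-3 * (lam + 3) * ρ / (5 + 3 * (ρ : ℂ) ^ 2)) ^ 2) * y (xmap ρ)
        + (2 * (-3 * (lam + 3) * ρ / (5 + 3 * (ρ : ℂ) ^ 2))
            * (80 * (ρ : ℂ) / (5 + 3 * (ρ : ℂ) ^ 2) ^ 2)
          + 80 * (5 - 9 * (ρ : ℂ) ^ 2) / (5 + 3 * (ρ : ℂ) ^ 2) ^ 3) * deriv y (xmap ρ)
        + (80 * (ρ : ℂ) / (5 + 3 * (ρ : ℂ) ^ 2) ^ 2) ^ 2 * deriv (deriv y) (xmap ρ)) := by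
  have heq : deriv (fTrans lam y) =ᶠ[nhds ρ] _ :=
    Filter.eventuallyEq_of_mem (isOpen_Ioo.mem_nhds hρ) fun r hr => deriv_fTrans hy hr
  rw [heq.deriv_eq]
  obtain ⟨h1, h2⟩ := hasDerivAt_of_contDiffOn hy (xmap_mem_Ioo hρ)
  have h := (hasDerivAt_weight lam ρ).mul
    (((hasDerivAt_ofReal_div ρ (-3 * (lam + 3))).mul h1.comp_xmap).add
      ((hasDerivAt_ofReal_div_sq ρ).mul h2.comp_xmap))
  refine (h.congr_deriv ?_).deriv
  simp only [Pi.add_apply, Pi.mul_apply]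
  ring

theorem spectralEq_fTrans_iff {lam : ℂ} {y : ℝ → ℂ} (hy : ContDiffOn ℝ 2 y (Ioo 0 1)) {ρ : ℝ}
    (hρ : ρ ∈ Ioo (0 : ℝ) 1) :
    SpectralEq lam (fTrans lam y) ρ ↔ HeunEq lam y (xmap ρ) := by
  have hq := ofReal_five_add_ne_zero ρ
  have hr : (ρ : ℂ) ≠ 0 := by exact_mod_cast hρ.1.ne'
  have hs : 1 - (ρ : ℂ) ^ 2 ≠ 0 := by
    have : 1 - ρ ^ 2 ≠ 0 := by nlinarith [hρ.1, hρ.2]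
    exact_mod_cast this
  have hw : weight lam ρ ≠ 0 := Complex.exp_ne_zero _
  have hf : fTrans lam y ρ = weight lam ρ * y (xmap ρ) := rfl
  have hx : (xmap ρ : ℂ) = 8 * (ρ : ℂ) ^ 2 / (5 + 3 * (ρ : ℂ) ^ 2) := by
    unfold xmap
    push_cast
    rfl
  have hx1 : 1 - (xmap ρ : ℂ) = 5 * (1 - (ρ : ℂ) ^ 2) / (5 + 3 * (ρ : ℂ) ^ 2) := by
    rw [hx, eq_div_iff hq, sub_mul, div_mul_cancel₀ _ hq]
    ring
  have hx8 : 8 - 3 * (xmap ρ : ℂ) = 40 / (5 + 3 * (ρ : ℂ) ^ 2) := by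
    rw [hx]
    field_simp
    ring
  have hk : -(1 - (ρ : ℂ) ^ 2) * (80 * (ρ : ℂ) / (5 + 3 * (ρ : ℂ) ^ 2) ^ 2) ^ 2
      * weight lam ρ ≠ 0 := by
    have h80 : (80 : ℂ) ≠ 0 := by norm_num
    exact mul_ne_zero (mul_ne_zero (neg_ne_zero.2 hs)
      (pow_ne_zero 2 (div_ne_zero (mul_ne_zero h80 hr) (pow_ne_zero 2 hq)))) hw
  unfold SpectralEq HeunEq
  refine Iff.trans (Eq.congr_left ?_) (mul_eq_zero_iff_left hk)
  rw [deriv_fTrans hy hρ, deriv_deriv_fTrans hy hρ, hf, mul_assoc 4, hx1, hx8, hx, Vt]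
  clear hk hf hx hx1 hx8
  generalize deriv (deriv y) (xmap ρ) = c
  generalize deriv y (xmap ρ) = b
  generalize y (xmap ρ) = a
  generalize weight lam ρ = w at *
  push_cast
  generalize (ρ : ℂ) = r at *
  generalize hqr : 5 + 3 * r ^ 2 = q at *
  generalize hsr : 1 - r ^ 2 = s at *
  field_simp
  subst hqr hsr
  ring

/-- `x(ρ)` is a strictly increasing bijection of `[0,1]` onto itself, and a `C²`
function `y` solves the Heun-type equation on `(0,1)` iff the corresponding
`f(ρ) = (8-3x(ρ))^((λ+3)/2)·y(x(ρ))` solves the spectral ODE on `(0,1)`. -/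
theorem stmt_12 (lam : ℂ) (y : ℝ → ℂ) (hy : ContDiffOn ℝ 2 y (Set.Ioo 0 1)) :
    StrictMonoOn xmap (Set.Icc 0 1) ∧
    Set.BijOn xmap (Set.Icc 0 1) (Set.Icc 0 1) ∧
    ((∀ x ∈ Set.Ioo (0 : ℝ) 1, HeunEq lam y x) ↔
      (∀ ρ ∈ Set.Ioo (0 : ℝ) 1, SpectralEq lam (fTrans lam y) ρ)) := by
  refine ⟨strictMonoOn_xmap, bijOn_xmap, fun h ρ hρ => ?_, fun h x hx => ?_⟩
  · exact (spectralEq_fTrans_iff hy hρ).2 (h _ (xmap_mem_Ioo hρ))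
  · obtain ⟨ρ, hρ, rfl⟩ := exists_xmap_eq hx
    exact (spectralEq_fTrans_iff hy hρ).1 (h ρ hρ)
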